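/- Let M₁ and M₂ be symmetric n×n real matrices whose eigenvalues all lie in the interval [0, b]. Then |det M₁ - det M₂| ≤ n · b^{n-1} · ‖M₁ - M₂‖, where ‖·‖ is the ℓ² operator norm. -/

import Mathlib

open Matrix

/-- The ℓ² operator norm of a real matrix. -/
noncomputable def l2OpNorm {n : ℕ} (A : Matrix (Fin n) (Fin n) ℝ) : ℝ :=
  ‖LinearMap.toContinuousLinearMap (Matrix.toEuclideanLin A)‖

lemma l2OpNorm_nonneg {n : ℕ} (A : Matrix (Fin n) (Fin n) ℝ) : 0 ≤ l2OpNorm A :=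
  norm_nonneg _

open scoped Matrix.Norms.L2Operator in
lemma Matrix.IsHermitian.l2OpNorm_eq_norm_eigenvalues {n : ℕ} {A : Matrix (Fin n) (Fin n) ℝ}
    (hA : A.IsHermitian) : l2OpNorm A = ‖hA.eigenvalues‖ := by
  change ‖A‖ = _
  conv_lhs => rw [hA.spectral_theorem, Unitary.conjStarAlgAut_apply, ← Unitary.coe_star]
  rw [CStarRing.norm_mul_coe_unitary, CStarRing.norm_coe_unitary_mul, Matrix.l2_opNorm_diagonal]
  rfl

lemma l2OpNorm_le_of_spectrum {n : ℕ} {b : ℝ} (hb : 0 ≤ b) {A : Matrix (Fin n) (Fin n) ℝ}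
    (hA : A.IsSymm) (hspec : ∀ μ ∈ spectrum ℝ A, |μ| ≤ b) : l2OpNorm A ≤ b := by
  have hA' : A.IsHermitian := by
    rwa [Matrix.IsHermitian, Matrix.conjTranspose_eq_transpose_of_trivial]
  rw [hA'.l2OpNorm_eq_norm_eigenvalues, pi_norm_le_iff_of_nonneg hb]
  exact fun i => hspec _ (hA'.eigenvalues_mem_spectrum_real i)

/-- Hadamard's inequality. -/
lemma EuclideanSpace.abs_det_basisFun_le {n : ℕ} (v : Fin n → EuclideanSpace ℝ (Fin n)) :
    |(EuclideanSpace.basisFun (Fin n) ℝ).toBasis.det v| ≤ ∏ i, ‖v i‖ := by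
  have : Fact (Module.finrank ℝ (EuclideanSpace ℝ (Fin n)) = n) := ⟨by simp⟩
  let o := (EuclideanSpace.basisFun (Fin n) ℝ).toBasis.orientation
  rw [← o.volumeForm_robust' (EuclideanSpace.basisFun (Fin n) ℝ)]
  exact o.abs_volumeForm_apply_le v

/-- The columns of a matrix, as vectors of Euclidean space. -/
noncomputable def euclideanCols {n : ℕ} (A : Matrix (Fin n) (Fin n) ℝ) :
    Fin n → EuclideanSpace ℝ (Fin n) :=
  fun j => Matrix.toEuclideanLin A (EuclideanSpace.basisFun (Fin n) ℝ j)

lemma norm_euclideanCols_le {n : ℕ} (A : Matrix (Fin n) (Fin n) ℝ) :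
    ‖euclideanCols A‖ ≤ l2OpNorm A := by
  rw [pi_norm_le_iff_of_nonneg (l2OpNorm_nonneg A)]
  intro j
  simpa [euclideanCols, l2OpNorm] using
    (LinearMap.toContinuousLinearMap (Matrix.toEuclideanLin A)).le_opNorm
      (EuclideanSpace.basisFun (Fin n) ℝ j)

lemma euclideanCols_sub {n : ℕ} (A B : Matrix (Fin n) (Fin n) ℝ) :
    euclideanCols (A - B) = euclideanCols A - euclideanCols B := by
  ext1 j
  simp [euclideanCols]

lemma det_euclideanCols {n : ℕ} (A : Matrix (Fin n) (Fin n) ℝ) :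
    (EuclideanSpace.basisFun (Fin n) ℝ).toBasis.det (euclideanCols A) = A.det := by
  rw [Module.Basis.det_apply]
  congr 1
  ext i j
  simp [euclideanCols, Module.Basis.toMatrix_apply, Matrix.toLpLin_apply]

/-- Lipschitz bound for the determinant in terms of the ℓ² operator norm. -/
lemma abs_det_sub_det_le {n : ℕ} (A B : Matrix (Fin n) (Fin n) ℝ) :
    |A.det - B.det| ≤ n * max (l2OpNorm A) (l2OpNorm B) ^ (n - 1) * l2OpNorm (A - B) := by
  have h := (EuclideanSpace.basisFun (Fin n) ℝ).toBasis.det.toMultilinearMap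
    |>.norm_image_sub_le_of_bound zero_le_one
      (fun m => by simpa using EuclideanSpace.abs_det_basisFun_le m)
      (euclideanCols A) (euclideanCols B)
  simp only [AlternatingMap.coe_multilinearMap, det_euclideanCols, Real.norm_eq_abs,
    Fintype.card_fin, one_mul, ← euclideanCols_sub] at h
  have := l2OpNorm_nonneg A
  refine h.trans ?_
  gcongr <;> first | positivity | exact norm_euclideanCols_le _

/-- Let `M₁` and `M₂` be symmetric `n×n` real matrices whose eigenvalues all
lie in the interval `[0, b]`.  Then `|det M₁ - det M₂| ≤ n · b^{n-1} · ‖M₁ - M₂‖`, where `‖·‖`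
is the ℓ² operator norm. -/
theorem det_perturbation_bound {n : ℕ} (b : ℝ) (M₁ M₂ : Matrix (Fin n) (Fin n) ℝ)
    (h₁ : M₁.IsSymm) (h₂ : M₂.IsSymm)
    (heig₁ : ∀ μ ∈ spectrum ℝ M₁, μ ∈ Set.Icc 0 b)
    (heig₂ : ∀ μ ∈ spectrum ℝ M₂, μ ∈ Set.Icc 0 b) :
    |M₁.det - M₂.det| ≤ n * b ^ (n - 1) * l2OpNorm (M₁ - M₂) := by
  rcases Nat.eq_zero_or_pos n with rfl | hn
  · simp
  have hM₁ : M₁.IsHermitian := by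
    rwa [Matrix.IsHermitian, Matrix.conjTranspose_eq_transpose_of_trivial]
  have hb : 0 ≤ b := by
    obtain ⟨h0, hle⟩ := heig₁ _ (hM₁.eigenvalues_mem_spectrum_real ⟨0, hn⟩)
    exact h0.trans hle
  have abs_le_of_mem {μ : ℝ} (hμ : μ ∈ Set.Icc 0 b) : |μ| ≤ b :=
    (abs_of_nonneg hμ.1).trans_le hμ.2
  refine (abs_det_sub_det_le M₁ M₂).trans ?_
  have := l2OpNorm_nonneg M₁
  have := l2OpNorm_nonneg (M₁ - M₂)
  gcongr
  exact max_le (l2OpNorm_le_of_spectrum hb h₁ fun μ hμ => abs_le_of_mem (heig₁ μ hμ))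
    (l2OpNorm_le_of_spectrum hb h₂ fun μ hμ => abs_le_of_mem (heig₂ μ hμ))
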